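/- Let ξ ∈ ℝ with 0 < ξ < α, let u ∈ C²([0,R)) be the solution of the Cauchy problem M⁺(u'') + g(u) = 0, u(0) = ξ, u'(0) = 0 on its maximal interval of existence [0,R), and let r₁ ∈ (0,R) be the first zero of u. Then for every r ∈ (r₁,R) such that −α < u(t) < 0 for all t ∈ (r₁, r], the energy identity (1/2) u'(r)² − G(ξ)/λ = −G(u(r))/Λ holds. -/

import Mathlib

open Set Filter Topology

/-- The energy of a solution of `c u'' + g(u) = 0` is conserved. -/
theorem energy_conserved {g u : ℝ → ℝ} (hg : Continuous g) {a b c : ℝ} (hab : a < b)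
    (hu : ContinuousOn u (Icc a b)) (hu' : ContinuousOn (deriv u) (Icc a b))
    (hd : ∀ t ∈ Ioo a b, DifferentiableAt ℝ u t)
    (hd' : ∀ t ∈ Ioo a b, DifferentiableAt ℝ (deriv u) t)
    (hode : ∀ t ∈ Ioo a b, c * deriv (deriv u) t + g (u t) = 0) :
    c / 2 * deriv u b ^ 2 + ∫ s in (0:ℝ)..u b, g s =
      c / 2 * deriv u a ^ 2 + ∫ s in (0:ℝ)..u a, g s := by
  have hG : ∀ x, HasDerivAt (fun x => ∫ s in (0:ℝ)..x, g s) (g x) x := fun x =>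
    intervalIntegral.integral_hasDerivAt_right (hg.intervalIntegrable _ _)
      (hg.stronglyMeasurableAtFilter _ _) hg.continuousAt
  have hGc : Continuous (fun x => ∫ s in (0:ℝ)..x, g s) :=
    continuous_iff_continuousAt.2 fun x => (hG x).continuousAt
  obtain ⟨t, ht, heq⟩ := exists_hasDerivAt_eq_slope
    (fun t => c / 2 * deriv u t ^ 2 + ∫ s in (0:ℝ)..u t, g s) (fun _ => 0) hab
    ((continuousOn_const.mul (hu'.pow 2)).add (hGc.comp_continuousOn hu))
    (fun t ht => by
      refine ((((hd' t ht).hasDerivAt.pow 2).const_mul (c / 2)).add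
        ((hG (u t)).comp t (hd t ht).hasDerivAt)).congr_deriv ?_
      push_cast
      linear_combination deriv u t * hode t ht)
  rw [eq_div_iff (sub_ne_zero.2 hab.ne')] at heq
  linarith

/-- A function that starts below `α` with zero slope and is strictly concave wherever it is below `α`
stays below `α`. -/
theorem lt_of_deriv_deriv_neg {u : ℝ → ℝ} {α b : ℝ} (h0 : u 0 < α) (h0' : deriv u 0 = 0)
    (hu : ContinuousOn u (Icc 0 b)) (hu' : ContinuousOn (deriv u) (Icc 0 b))
    (hneg : ∀ t ∈ Ioo 0 b, u t < α → deriv (deriv u) t < 0) :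
    ∀ t ∈ Icc 0 b, u t < α := by
  by_contra! hcon
  obtain ⟨t, ht, htα⟩ := hcon
  have hcl : IsClosed (Icc 0 b ∩ u ⁻¹' Ici α) :=
    hu.preimage_isClosed_of_isClosed isClosed_Icc isClosed_Ici
  obtain ⟨τ, ⟨hτ, hτα⟩, hmin⟩ :=
    (isCompact_Icc.of_isClosed_subset hcl inter_subset_left).exists_isLeast ⟨t, ht, htα⟩
  simp only [mem_preimage, mem_Ici] at hτα
  have hτ0 : 0 < τ := hτ.1.lt_of_ne fun h => by rw [← h] at hτα; linarith
  have hsub : Icc 0 τ ⊆ Icc 0 b := Icc_subset_Icc_right hτ.2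
  have hlt : ∀ s ∈ Ioo 0 τ, u s < α := fun s hs => by
    by_contra! h
    exact absurd (hmin ⟨hsub (Ioo_subset_Icc_self hs), h⟩) (not_le.2 hs.2)
  have hanti' : StrictAntiOn (deriv u) (Icc 0 τ) :=
    strictAntiOn_of_deriv_neg (convex_Icc 0 τ) (hu'.mono hsub) fun s hs => by
      rw [interior_Icc] at hs
      exact hneg s ⟨hs.1, hs.2.trans_le hτ.2⟩ (hlt s hs)
  have hanti : StrictAntiOn u (Icc 0 τ) :=
    strictAntiOn_of_deriv_neg (convex_Icc 0 τ) (hu.mono hsub) fun s hs => by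
      rw [interior_Icc] at hs
      exact h0' ▸ hanti' (left_mem_Icc.2 hτ0.le) (Ioo_subset_Icc_self hs) hs.1
  have := hanti (left_mem_Icc.2 hτ0.le) (right_mem_Icc.2 hτ0.le) hτ0
  linarith

theorem pucci_1d_plus_energy_identity
    (lam Lam : ℝ) (hlam : 0 < lam) (hlamLam : lam ≤ Lam)
    (g : ℝ → ℝ) (hg1 : LocallyLipschitz g)
    (hg2 : ∀ t, g (-t) = - g t)
    (α : ℝ) (hα : 0 < α)
    (hg3pos : ∀ t, 0 < t → t < α → 0 < g t)
    (hg3neg : ∀ t, α < t → g t < 0)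
    (G : ℝ → ℝ) (hG : ∀ t, G t = ∫ s in (0:ℝ)..t, g s)
    (ξ : ℝ) (hξ0 : 0 < ξ) (hξα : ξ < α)
    (R : EReal) (hR : 0 < R)
    (u : ℝ → ℝ)
    (hu : ContDiffOn ℝ 2 u {r : ℝ | 0 ≤ r ∧ (r : EReal) < R})
    (hode : ∀ r : ℝ, 0 ≤ r → (r : EReal) < R →
      (if 0 ≤ deriv (deriv u) r then Lam * deriv (deriv u) r
        else lam * deriv (deriv u) r) + g (u r) = 0)
    (hu0 : u 0 = ξ) (hu'0 : deriv u 0 = 0)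
    (hmax : ¬ ∃ (R' : EReal) (v : ℝ → ℝ), R < R' ∧
      ContDiffOn ℝ 2 v {r : ℝ | 0 ≤ r ∧ (r : EReal) < R'} ∧
      (∀ r : ℝ, 0 ≤ r → (r : EReal) < R' →
        (if 0 ≤ deriv (deriv v) r then Lam * deriv (deriv v) r
        else lam * deriv (deriv v) r) + g (v r) = 0) ∧
      v 0 = ξ ∧ deriv v 0 = 0 ∧
      (∀ r : ℝ, 0 ≤ r → (r : EReal) < R → v r = u r))
    (r₁ : ℝ) (hr₁0 : 0 < r₁) (hr₁R : (r₁ : EReal) < R)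
    (hur₁ : u r₁ = 0) (hupos : ∀ r, 0 ≤ r → r < r₁ → 0 < u r) :
    ∀ r : ℝ, r₁ < r → (r : EReal) < R →
      (∀ t, r₁ < t → t ≤ r → -α < u t ∧ u t < 0) →
      (1 / 2) * (deriv u r) ^ 2 - G ξ / lam = - G (u r) / Lam := by
  intro r hr hrR hneg
  have hg : Continuous g := hg1.continuous
  have hLam : 0 < Lam := hlam.trans_le hlamLam
  have hlt : ∀ t, t ≤ r → (t : EReal) < R := fun t ht =>
    (EReal.coe_le_coe_iff.2 ht).trans_lt hrR
  have hC : ∀ t, 0 < t → t ≤ r → ContDiffAt ℝ 2 u t := fun t ht htr => by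
    refine hu.contDiffAt ?_
    filter_upwards [Ioi_mem_nhds ht,
      (isOpen_Iio.preimage continuous_coe_real_ereal).mem_nhds (hlt t htr)] with s hs hs'
    exact ⟨le_of_lt hs, hs'⟩
  have hd : ∀ t, 0 < t → t ≤ r → DifferentiableAt ℝ u t := fun t ht htr =>
    (hC t ht htr).differentiableAt (by norm_num)
  have hd' : ∀ t, 0 < t → t ≤ r → DifferentiableAt ℝ (deriv u) t := fun t ht htr =>
    (((hC t ht htr).fderiv_right (m := 1) (by norm_num)).differentiableAt
      (by norm_num)).clm_apply (differentiableAt_const 1)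
  -- The equation at `0` forces a nonzero second derivative there.
  have hd'0 : DifferentiableAt ℝ (deriv u) 0 := by
    by_contra h
    have h1 := hode 0 le_rfl (hlt 0 (hr₁0.trans hr).le)
    rw [deriv_zero_of_not_differentiableAt h, hu0] at h1
    have := hg3pos ξ hξ0 hξα
    simp at h1
    linarith
  have huc : ContinuousOn u (Icc 0 r) := hu.continuousOn.mono fun t ht => ⟨ht.1, hlt t ht.2⟩
  have huc' : ContinuousOn (deriv u) (Icc 0 r) := fun t ht => by
    rcases ht.1.eq_or_lt with rfl | h
    · exact hd'0.continuousAt.continuousWithinAt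
    · exact (hd' t h ht.2).continuousAt.continuousWithinAt
  have hconc : ∀ t, 0 ≤ t → t ≤ r → 0 < g (u t) →
      deriv (deriv u) t < 0 ∧ lam * deriv (deriv u) t + g (u t) = 0 := fun t ht htr hgt => by
    have h := hode t ht (hlt t htr)
    split_ifs at h with h0
    · have := mul_nonneg hLam.le h0
      linarith
    · exact ⟨not_le.1 h0, h⟩
  have hconv : ∀ t, 0 ≤ t → t ≤ r → g (u t) < 0 →
      Lam * deriv (deriv u) t + g (u t) = 0 := fun t ht htr hgt => by
    have h := hode t ht (hlt t htr)
    split_ifs at h with h0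
    · exact h
    · have := mul_neg_of_pos_of_neg hlam (not_le.1 h0)
      linarith
  have hsub : Icc 0 r₁ ⊆ Icc 0 r := Icc_subset_Icc_right hr.le
  have hsub' : Icc r₁ r ⊆ Icc 0 r := Icc_subset_Icc_left hr₁0.le
  have huα := lt_of_deriv_deriv_neg (hu0.trans_lt hξα) hu'0 (huc.mono hsub) (huc'.mono hsub)
    fun t ht htα => (hconc t ht.1.le (ht.2.trans hr).le
      (hg3pos _ (hupos t ht.1.le ht.2) htα)).1
  have e1 := energy_conserved hg (c := lam) hr₁0 (huc.mono hsub) (huc'.mono hsub)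
    (fun t ht => hd t ht.1 (ht.2.trans hr).le) (fun t ht => hd' t ht.1 (ht.2.trans hr).le)
    fun t ht => (hconc t ht.1.le (ht.2.trans hr).le
      (hg3pos _ (hupos t ht.1.le ht.2) (huα t (Ioo_subset_Icc_self ht)))).2
  have e2 := energy_conserved hg (c := Lam) hr (huc.mono hsub') (huc'.mono hsub')
    (fun t ht => hd t (hr₁0.trans ht.1) ht.2.le) (fun t ht => hd' t (hr₁0.trans ht.1) ht.2.le)
    fun t ht => hconv t (hr₁0.trans ht.1).le ht.2.le <| by
      obtain ⟨h1, h2⟩ := hneg t ht.1 ht.2.le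
      have := hg3pos (-u t) (by linarith) (by linarith)
      rw [hg2] at this
      linarith
  rw [← hG, ← hG, hur₁, hu0, hu'0, hG 0, intervalIntegral.integral_same] at e1
  rw [← hG, ← hG, hur₁, hG 0, intervalIntegral.integral_same] at e2
  field_simp
  linear_combination 2 * lam * e2 + 2 * Lam * e1
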